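/- arXiv:2605.06732 — 2 statements merged into one kernel-verified Lean document; each statement's English description precedes it below -/
import Mathlib

section
/- Simulation error decomposition (Lemma 1). Under the trajectory setup below, if γ·L_f·(1 + L_π) < 1, then for every initial state s₀ the discounted returns satisfy |J − Ĵ| ≤ ε_rew/(1 − γ) + (γ·L_r·(1 + L_π) / ((1 − γ)·(1 − γ·L_f·(1 + L_π))))·ε_dyn. -/
/-- Partial sums of a geometric series with ratio in `[0, 1)` are at most `1 / (1 - γ)`. -/
theorem geom_partial_sum_le {γ : ℝ} (hγ0 : 0 ≤ γ) (hγ1 : γ < 1) (n : ℕ) :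
    ∑ t ∈ Finset.range n, γ ^ t ≤ 1 / (1 - γ) := by
  rw [one_div, ← tsum_geometric_of_lt_one hγ0 hγ1]
  exact (summable_geometric_of_lt_one hγ0 hγ1).sum_le_tsum _ fun t _ => pow_nonneg hγ0 t

/-- A discounted Grönwall inequality: partial discounted sums of a sequence starting at `0` and
growing at most affinely. -/
theorem discounted_partial_sum_le {γ K ε : ℝ} {d : ℕ → ℝ} (hγ0 : 0 ≤ γ) (hγ1 : γ < 1)
    (hK : 0 ≤ K) (hγK : γ * K < 1) (hε : 0 ≤ ε) (hd0 : d 0 = 0)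
    (hd : ∀ t, d (t + 1) ≤ K * d t + ε) (n : ℕ) :
    ∑ t ∈ Finset.range n, γ ^ t * d t ≤ γ * ε / ((1 - γ) * (1 - γ * K)) := by
  have h1 : 0 < 1 - γ := sub_pos.2 hγ1
  have h2 : 0 < 1 - γ * K := sub_pos.2 hγK
  induction n with
  | zero => rw [Finset.sum_range_zero]; positivity
  | succ n ih =>
    calc ∑ t ∈ Finset.range (n + 1), γ ^ t * d t
        = ∑ t ∈ Finset.range n, γ ^ (t + 1) * d (t + 1) := by
          rw [Finset.sum_range_succ', hd0, mul_zero, add_zero]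
      _ ≤ ∑ t ∈ Finset.range n, γ ^ (t + 1) * (K * d t + ε) :=
          Finset.sum_le_sum fun t _ => mul_le_mul_of_nonneg_left (hd t) (pow_nonneg hγ0 _)
      _ = γ * K * ∑ t ∈ Finset.range n, γ ^ t * d t
            + γ * ε * ∑ t ∈ Finset.range n, γ ^ t := by
          rw [Finset.mul_sum, Finset.mul_sum, ← Finset.sum_add_distrib]
          exact Finset.sum_congr rfl fun t _ => by ring
      _ ≤ γ * K * (γ * ε / ((1 - γ) * (1 - γ * K))) + γ * ε * (1 / (1 - γ)) := by
          gcongr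
          exact geom_partial_sum_le hγ0 hγ1 n
      _ = γ * ε / ((1 - γ) * (1 - γ * K)) := by
          field_simp
          ring

/-- The discounted series of a bounded sequence is summable. -/
theorem summable_discounted_of_bounded {γ C : ℝ} {u : ℕ → ℝ} (hγ0 : 0 ≤ γ) (hγ1 : γ < 1)
    (hu : ∀ t, |u t| ≤ C) : Summable fun t => γ ^ t * u t := by
  refine Summable.of_norm_bounded ((summable_geometric_of_lt_one hγ0 hγ1).mul_right C)
    fun t => ?_
  rw [Real.norm_eq_abs, abs_mul, abs_of_nonneg (pow_nonneg hγ0 t)]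
  exact mul_le_mul_of_nonneg_left (hu t) (pow_nonneg hγ0 t)


/-- Simulation error decomposition (Lemma 1): with `γ L_f (1+L_π) < 1`, the gap between the
discounted return `J = ∑ γ^t r(s_t, a_t)` of the true trajectory and the discounted return
`Ĵ = ∑ γ^t r̂(ŝ_t, â_t)` of the imagined trajectory satisfies
`|J - Ĵ| ≤ ε_rew/(1-γ) + (γ L_r (1+L_π)/((1-γ)(1-γL_f(1+L_π))))·ε_dyn`. -/
theorem simulation_error_decomposition {ds da : ℕ}
    (f fhat : EuclideanSpace ℝ (Fin ds) → EuclideanSpace ℝ (Fin da) →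
      EuclideanSpace ℝ (Fin ds))
    (r rhat : EuclideanSpace ℝ (Fin ds) → EuclideanSpace ℝ (Fin da) → ℝ)
    (π : EuclideanSpace ℝ (Fin ds) → EuclideanSpace ℝ (Fin da))
    (γ Lf Lr Lπ εdyn εrew C : ℝ)
    (hγ0 : 0 ≤ γ) (hγ1 : γ < 1)
    (hLf : 0 ≤ Lf) (hLr : 0 ≤ Lr) (hLπ : 0 ≤ Lπ)
    (hlipf : ∀ s s' a a', ‖f s a - f s' a'‖ ≤ Lf * (‖s - s'‖ + ‖a - a'‖))
    (hlipr : ∀ s s' a a', |r s a - r s' a'| ≤ Lr * (‖s - s'‖ + ‖a - a'‖))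
    (hlipπ : ∀ s s', ‖π s - π s'‖ ≤ Lπ * ‖s - s'‖)
    (hεdyn : ∀ s a, ‖fhat s a - f s a‖ ≤ εdyn)
    (hεrew : ∀ s a, |rhat s a - r s a| ≤ εrew)
    (hrbdd : ∀ s a, |r s a| ≤ C)
    (hcontr : γ * Lf * (1 + Lπ) < 1)
    (s₀ : EuclideanSpace ℝ (Fin ds))
    (s shat : ℕ → EuclideanSpace ℝ (Fin ds))
    (hs0 : s 0 = s₀) (hshat0 : shat 0 = s₀)
    (hs : ∀ t, s (t + 1) = f (s t) (π (s t)))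
    (hshat : ∀ t, shat (t + 1) = fhat (shat t) (π (shat t))) :
    |(∑' t : ℕ, γ ^ t * r (s t) (π (s t)))
        - (∑' t : ℕ, γ ^ t * rhat (shat t) (π (shat t)))|
      ≤ εrew / (1 - γ)
        + (γ * Lr * (1 + Lπ) / ((1 - γ) * (1 - γ * Lf * (1 + Lπ)))) * εdyn := by
  have hεd : 0 ≤ εdyn := (norm_nonneg _).trans (hεdyn s₀ (π s₀))
  have hεr : 0 ≤ εrew := (abs_nonneg _).trans (hεrew s₀ (π s₀))
  have hdyn : ∀ t, ‖s (t + 1) - shat (t + 1)‖ ≤ Lf * (1 + Lπ) * ‖s t - shat t‖ + εdyn := by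
    intro t
    rw [hs, hshat]
    calc ‖f (s t) (π (s t)) - fhat (shat t) (π (shat t))‖
        ≤ ‖f (s t) (π (s t)) - f (shat t) (π (shat t))‖
          + ‖f (shat t) (π (shat t)) - fhat (shat t) (π (shat t))‖ :=
          norm_sub_le_norm_sub_add_norm_sub _ _ _
      _ ≤ Lf * (‖s t - shat t‖ + Lπ * ‖s t - shat t‖) + εdyn := by
          refine add_le_add ((hlipf _ _ _ _).trans ?_) ?_
          · gcongr
            exact hlipπ _ _
          · rw [norm_sub_rev]
            exact hεdyn _ _
      _ = Lf * (1 + Lπ) * ‖s t - shat t‖ + εdyn := by ring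
  have hrew : ∀ t, |r (s t) (π (s t)) - rhat (shat t) (π (shat t))|
      ≤ εrew + Lr * (1 + Lπ) * ‖s t - shat t‖ := by
    intro t
    calc |r (s t) (π (s t)) - rhat (shat t) (π (shat t))|
        ≤ |r (s t) (π (s t)) - r (shat t) (π (shat t))|
          + |r (shat t) (π (shat t)) - rhat (shat t) (π (shat t))| := abs_sub_le _ _ _
      _ ≤ Lr * (‖s t - shat t‖ + Lπ * ‖s t - shat t‖) + εrew := by
          refine add_le_add ((hlipr _ _ _ _).trans ?_) ?_
          · gcongr
            exact hlipπ _ _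
          · rw [abs_sub_comm]
            exact hεrew _ _
      _ = εrew + Lr * (1 + Lπ) * ‖s t - shat t‖ := by ring
  have hsum : Summable fun t => γ ^ t * r (s t) (π (s t)) :=
    summable_discounted_of_bounded hγ0 hγ1 fun t => hrbdd _ _
  have hsumhat : Summable fun t => γ ^ t * rhat (shat t) (π (shat t)) := by
    refine summable_discounted_of_bounded (C := εrew + C) hγ0 hγ1 fun t => ?_
    calc |rhat (shat t) (π (shat t))|
        = |(rhat (shat t) (π (shat t)) - r (shat t) (π (shat t)))
            + r (shat t) (π (shat t))| := by rw [sub_add_cancel]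
      _ ≤ εrew + C := (abs_add_le _ _).trans (add_le_add (hεrew _ _) (hrbdd _ _))
  refine le_of_tendsto' (hsum.hasSum.sub hsumhat.hasSum).tendsto_sum_nat.abs fun n => ?_
  calc |∑ t ∈ Finset.range n,
          (γ ^ t * r (s t) (π (s t)) - γ ^ t * rhat (shat t) (π (shat t)))|
      ≤ ∑ t ∈ Finset.range n, γ ^ t * (εrew + Lr * (1 + Lπ) * ‖s t - shat t‖) := by
        refine (Finset.abs_sum_le_sum_abs _ _).trans (Finset.sum_le_sum fun t _ => ?_)
        rw [← mul_sub, abs_mul, abs_of_nonneg (pow_nonneg hγ0 t)]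
        exact mul_le_mul_of_nonneg_left (hrew t) (pow_nonneg hγ0 t)
    _ = εrew * ∑ t ∈ Finset.range n, γ ^ t
          + Lr * (1 + Lπ) * ∑ t ∈ Finset.range n, γ ^ t * ‖s t - shat t‖ := by
        rw [Finset.mul_sum, Finset.mul_sum, ← Finset.sum_add_distrib]
        exact Finset.sum_congr rfl fun t _ => by ring
    _ ≤ εrew * (1 / (1 - γ))
          + Lr * (1 + Lπ) * (γ * εdyn / ((1 - γ) * (1 - γ * (Lf * (1 + Lπ))))) := by
        gcongr
        · exact geom_partial_sum_le hγ0 hγ1 n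
        · exact discounted_partial_sum_le hγ0 hγ1 (by positivity) (by rwa [← mul_assoc]) hεd
            (by rw [hs0, hshat0, sub_self, norm_zero]) hdyn n
    _ = εrew / (1 - γ)
          + (γ * Lr * (1 + Lπ) / ((1 - γ) * (1 - γ * Lf * (1 + Lπ)))) * εdyn := by
        rw [← mul_assoc γ Lf]
        ring
end

section
/- Temporal straightening from a Lipschitz latent velocity map (Proposition). Let Z be a real inner product space, let f : Z → Z, define v(z) := f(z) − z, and let z_{t+1} = f(z_t) be a rollout. Assume v is ε-Lipschitz on the states visited by the rollout, with 0 < ε < 1. Then for any t with v(z_t) ≠ 0 and v(z_{t+1}) ≠ 0, the curvature loss satisfies L_curv(t) := 1 − ⟨v(z_t), v(z_{t+1})⟩ / (‖v(z_t)‖·‖v(z_{t+1})‖) ≤ ε² / (2(1 − ε)). -/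
open scoped RealInnerProductSpace

/-- A vector `w` whose distance to `u` is at most `ε‖u‖` has cosine similarity with `u` at least
`1 - ε²/(2(1-ε))`. -/
theorem one_sub_inner_div_norm_mul_norm_le {Z : Type*} [NormedAddCommGroup Z]
    [InnerProductSpace ℝ Z] {u w : Z} {ε : ℝ} (hε1 : ε < 1) (hu : u ≠ 0) (hw : w ≠ 0)
    (h : ‖w - u‖ ≤ ε * ‖u‖) :
    1 - ⟪u, w⟫ / (‖u‖ * ‖w‖) ≤ ε ^ 2 / (2 * (1 - ε)) := by
  have ha : 0 < ‖u‖ := norm_pos_iff.mpr hu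
  have hb : 0 < ‖w‖ := norm_pos_iff.mpr hw
  have hε : 0 < 1 - ε := sub_pos.mpr hε1
  have hlow : (1 - ε) * ‖u‖ ≤ ‖w‖ := by
    linarith [norm_sub_norm_le u w, norm_sub_rev u w]
  have hsq : ‖w - u‖ ^ 2 ≤ (ε * ‖u‖) ^ 2 := pow_le_pow_left₀ (norm_nonneg _) h 2
  have hnum : 2 * (‖u‖ * ‖w‖ - ⟪u, w⟫) ≤ ε ^ 2 * ‖u‖ ^ 2 := by
    rw [norm_sub_sq_real, real_inner_comm] at hsq
    nlinarith [sq_nonneg (‖u‖ - ‖w‖)]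
  rw [one_sub_div (by positivity), div_le_div_iff₀ (by positivity) (by positivity)]
  calc (‖u‖ * ‖w‖ - ⟪u, w⟫) * (2 * (1 - ε))
      = 2 * (‖u‖ * ‖w‖ - ⟪u, w⟫) * (1 - ε) := by ring
    _ ≤ ε ^ 2 * ‖u‖ ^ 2 * (1 - ε) := by gcongr
    _ = ε ^ 2 * (‖u‖ * ((1 - ε) * ‖u‖)) := by ring
    _ ≤ ε ^ 2 * (‖u‖ * ‖w‖) := by gcongr

/-- Temporal straightening from a Lipschitz latent velocity map: if the latent velocity map
`v(z) = f(z) - z` is `ε`-Lipschitz along a rollout `z_{t+1} = f(z_t)` with `0 < ε < 1`, then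
for any `t` with `v(z_t) ≠ 0` and `v(z_{t+1}) ≠ 0`, the curvature loss
`1 - ⟨v(z_t), v(z_{t+1})⟩/(‖v(z_t)‖‖v(z_{t+1})‖)` is at most `ε²/(2(1-ε))`. -/
theorem temporal_straightening_from_lipschitz_velocity
    {Z : Type*} [NormedAddCommGroup Z] [InnerProductSpace ℝ Z]
    (f : Z → Z) (v : Z → Z) (hv : ∀ z, v z = f z - z)
    (z : ℕ → Z) (hroll : ∀ t, z (t + 1) = f (z t))
    (ε : ℝ) (hε0 : 0 < ε) (hε1 : ε < 1)
    (hlip : ∀ t, ‖v (z (t + 1)) - v (z t)‖ ≤ ε * ‖z (t + 1) - z t‖)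
    (t : ℕ) (ht : v (z t) ≠ 0) (ht' : v (z (t + 1)) ≠ 0) :
    1 - ⟪v (z t), v (z (t + 1))⟫ / (‖v (z t)‖ * ‖v (z (t + 1))‖)
      ≤ ε ^ 2 / (2 * (1 - ε)) := by
  refine one_sub_inner_div_norm_mul_norm_le hε1 ht ht' ?_
  simpa only [hv (z t), hroll t] using hlip t
end
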